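/- For 0 < q < 1 and integers n, m, l, the ₁φ₁ q-Bessel functions satisfy the Hansen–Lommel type orthogonality Σ_{k∈ℤ} q^{k+n} J_{k+n}(q^l; q²) · q^{k+m} J_{k+m}(q^l; q²) = δ_{nm}. -/

import Mathlib

/-- The finite q-shifted factorial `(a;q)_k`. -/
noncomputable def qp (q a : ℝ) (k : ℕ) : ℝ := ∏ i ∈ Finset.range k, (1 - a * q ^ i)

/-- The infinite q-shifted factorial `(a;q)_∞`. -/
noncomputable def qpInf (q a : ℝ) : ℝ := ∏' i : ℕ, (1 - a * q ^ i)

/-- The Wall polynomial `p_n(x;a;q) = ₂φ₁(q^{-n},0;aq;q,qx)` as a terminating sum. -/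
noncomputable def wall (n : ℕ) (x a q : ℝ) : ℝ :=
  ∑ j ∈ Finset.range (n + 1), qp q (q ^ (-(n : ℤ))) j / (qp q (a * q) j * qp q q j) * (q * x) ^ j
/-- The `₁φ₁` q-Bessel function `J_n(x;q²)` of integer order `n`, in the combined form
`x^n (q²;q²)_∞⁻¹ Σ_k (-1)^k q^{k(k-1)} (q²x²)^k (q^{2n+2+2k};q²)_∞ / (q²;q²)_k`,
which encodes the standard convention for negative integer order. -/
noncomputable def Jz (q : ℝ) (n : ℤ) (x : ℝ) : ℝ :=
  x ^ n * (∑' k : ℕ, (-1) ^ k * q ^ (k * (k - 1)) * (q ^ 2 * x ^ 2) ^ k *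
      qpInf (q ^ 2) (q ^ (2 * n + 2 + 2 * (k : ℤ))) / qp (q ^ 2) (q ^ 2) k) /
    qpInf (q ^ 2) (q ^ 2)


open Filter Topology

/-- The coefficients `(-1)^k q^{k(k-1)} z^k / (q²;q²)_k` of the expansion of `(z;q²)_∞`. -/
noncomputable def qExpBig (q z : ℝ) (k : ℕ) : ℝ :=
  (-1) ^ k * q ^ (k * (k - 1)) * z ^ k / qp (q ^ 2) (q ^ 2) k

/-- The coefficients `z^k / (q²;q²)_k` of the expansion of `1 / (z;q²)_∞`. -/
noncomputable def qExpSmall (q z : ℝ) (k : ℕ) : ℝ := z ^ k / qp (q ^ 2) (q ^ 2) k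

theorem one_sub_sq_pow_pos {q : ℝ} (hq0 : 0 < q) (hq1 : q < 1) (k : ℕ) :
    0 < 1 - (q ^ 2) ^ (k + 1) := by
  have h : q ^ 2 < 1 := by nlinarith
  have := pow_lt_one₀ (sq_nonneg q) h (Nat.succ_ne_zero k)
  exact sub_pos.mpr this

theorem qp_succ (q a : ℝ) (k : ℕ) : qp q a (k + 1) = qp q a k * (1 - a * q ^ k) :=
  Finset.prod_range_succ _ _

theorem qp_sq_succ (q : ℝ) (k : ℕ) :
    qp (q ^ 2) (q ^ 2) (k + 1) = qp (q ^ 2) (q ^ 2) k * (1 - (q ^ 2) ^ (k + 1)) := by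
  rw [qp_succ, pow_succ' (q ^ 2) k]

theorem qp_sq_pos {q : ℝ} (hq0 : 0 < q) (hq1 : q < 1) (k : ℕ) :
    0 < qp (q ^ 2) (q ^ 2) k := by
  induction k with
  | zero => simp [qp]
  | succ k ih =>
    rw [qp_sq_succ]
    exact mul_pos ih (one_sub_sq_pow_pos hq0 hq1 k)

theorem qExpBig_succ {q : ℝ} (hq0 : 0 < q) (hq1 : q < 1) (z : ℝ) (k : ℕ) :
    qExpBig q z (k + 1) = -((q ^ 2) ^ k * z / (1 - (q ^ 2) ^ (k + 1))) * qExpBig q z k := by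
  have h1 := (one_sub_sq_pow_pos hq0 hq1 k).ne'
  have h2 := (qp_sq_pos hq0 hq1 k).ne'
  have h3 : (k + 1) * (k + 1 - 1) = k * (k - 1) + 2 * k := by
    cases k with
    | zero => rfl
    | succ k => simp only [Nat.add_sub_cancel]; ring
  rw [qExpBig, qExpBig, h3, qp_sq_succ, pow_add q, pow_mul q 2 k]
  field_simp
  ring

theorem qExpSmall_succ {q : ℝ} (hq0 : 0 < q) (hq1 : q < 1) (z : ℝ) (k : ℕ) :
    qExpSmall q z (k + 1) = z / (1 - (q ^ 2) ^ (k + 1)) * qExpSmall q z k := by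
  have h1 := (one_sub_sq_pow_pos hq0 hq1 k).ne'
  have h2 := (qp_sq_pos hq0 hq1 k).ne'
  rw [qExpSmall, qExpSmall, qp_sq_succ]
  field_simp
  ring

theorem summable_of_succ_eq_mul {f r : ℕ → ℝ} {ρ : ℝ} (hf : ∀ k, f (k + 1) = r k * f k)
    (hr : Tendsto r atTop (𝓝 ρ)) (hρ : |ρ| < 1) : Summable f := by
  obtain ⟨s, hs, hs1⟩ := exists_between hρ
  refine summable_of_ratio_norm_eventually_le hs1 ?_
  filter_upwards [hr.abs.eventually_lt_const hs] with k hk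
  rw [hf, norm_mul]
  exact mul_le_mul_of_nonneg_right hk.le (norm_nonneg _)

theorem tendsto_sq_pow {q : ℝ} (hq0 : 0 < q) (hq1 : q < 1) :
    Tendsto (fun k : ℕ => (q ^ 2) ^ k) atTop (𝓝 0) :=
  tendsto_pow_atTop_nhds_zero_of_lt_one (sq_nonneg q) (by nlinarith)

theorem summable_qExpBig {q : ℝ} (hq0 : 0 < q) (hq1 : q < 1) (z : ℝ) :
    Summable (qExpBig q z) := by
  refine summable_of_succ_eq_mul (ρ := 0) (qExpBig_succ hq0 hq1 z) ?_ (by simp)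
  have h := tendsto_sq_pow hq0 hq1
  have h1 := (h.comp (tendsto_add_atTop_nat 1)).const_sub 1
  have := ((h.mul_const z).div h1 (by simp)).neg
  simpa using this

theorem summable_qExpSmall {q : ℝ} (hq0 : 0 < q) (hq1 : q < 1) {z : ℝ} (hz : |z| < 1) :
    Summable (qExpSmall q z) := by
  refine summable_of_succ_eq_mul (ρ := z) (qExpSmall_succ hq0 hq1 z) ?_ hz
  have h1 := ((tendsto_sq_pow hq0 hq1).comp (tendsto_add_atTop_nat 1)).const_sub 1
  simpa [div_eq_mul_inv] using (h1.inv₀ (by simp)).const_mul z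

theorem qExpBig_mul_pow (q z c : ℝ) (k : ℕ) :
    qExpBig q (c * z) k = c ^ k * qExpBig q z k := by
  rw [qExpBig, qExpBig, mul_pow]; ring

theorem tsum_qExpBig_eq {q : ℝ} (hq0 : 0 < q) (hq1 : q < 1) (z : ℝ) :
    ∑' k, qExpBig q z k = (1 - z) * ∑' k, qExpBig q (q ^ 2 * z) k := by
  have h1 := summable_qExpBig hq0 hq1 z
  have h2 := summable_qExpBig hq0 hq1 (q ^ 2 * z)
  have h : ∑' k, (qExpBig q z k - qExpBig q (q ^ 2 * z) k) =
      -z * ∑' k, qExpBig q (q ^ 2 * z) k := by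
    rw [(h1.sub h2).tsum_eq_zero_add, ← tsum_mul_left]
    have h0 : qExpBig q z 0 - qExpBig q (q ^ 2 * z) 0 = 0 := by simp [qExpBig]
    rw [h0, zero_add]
    refine tsum_congr fun k => ?_
    have h3 := (one_sub_sq_pow_pos hq0 hq1 k).ne'
    rw [qExpBig_mul_pow, qExpBig_mul_pow, qExpBig_succ hq0 hq1]
    field_simp
    ring
  rw [h1.tsum_sub h2] at h
  linarith

theorem multipliable_qpInf {q : ℝ} (hq0 : 0 < q) (hq1 : q < 1) (z : ℝ) :
    Multipliable fun i : ℕ => 1 - z * (q ^ 2) ^ i := by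
  have h : Summable fun i : ℕ => -(z * (q ^ 2) ^ i) :=
    ((summable_geometric_of_lt_one (sq_nonneg q) (by nlinarith)).mul_left z).neg
  simpa [sub_eq_add_neg] using Real.multipliable_one_add_of_summable h

theorem tendsto_qp {q : ℝ} (hq0 : 0 < q) (hq1 : q < 1) (z : ℝ) :
    Tendsto (qp (q ^ 2) z) atTop (𝓝 (qpInf (q ^ 2) z)) :=
  (multipliable_qpInf hq0 hq1 z).hasProd.tendsto_prod_nat

theorem tsum_qExpBig_eq_qp_mul {q : ℝ} (hq0 : 0 < q) (hq1 : q < 1) (z : ℝ) (N : ℕ) :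
    ∑' k, qExpBig q z k = qp (q ^ 2) z N * ∑' k, qExpBig q ((q ^ 2) ^ N * z) k := by
  induction N with
  | zero => simp [qp]
  | succ N ih =>
    rw [ih, tsum_qExpBig_eq hq0 hq1 ((q ^ 2) ^ N * z), qp_succ, pow_succ' (q ^ 2) N]
    ring_nf

/-- Euler's expansion of the infinite product `(z;q²)_∞`. -/
theorem qpInf_eq_tsum {q : ℝ} (hq0 : 0 < q) (hq1 : q < 1) (z : ℝ) :
    qpInf (q ^ 2) z = ∑' k, qExpBig q z k := by
  have hlim : Tendsto (fun N : ℕ => ∑' k, qExpBig q ((q ^ 2) ^ N * z) k) atTop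
      (𝓝 (∑' k : ℕ, if k = 0 then 1 else 0)) := by
    refine tendsto_tsum_of_dominated_convergence (summable_qExpBig hq0 hq1 z).norm
      (fun k => ?_) (Eventually.of_forall fun N k => ?_)
    · simp only [qExpBig_mul_pow]
      rcases eq_or_ne k 0 with rfl | hk
      · simp [qExpBig, qp]
      · have := ((tendsto_sq_pow hq0 hq1).pow k).mul_const (qExpBig q z k)
        simpa [hk] using this
    · rw [qExpBig_mul_pow, norm_mul]
      refine mul_le_of_le_one_left (norm_nonneg _) ?_
      rw [norm_pow, norm_pow, norm_pow, Real.norm_of_nonneg hq0.le]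
      exact pow_le_one₀ (by positivity) (pow_le_one₀ (by positivity)
        (pow_le_one₀ hq0.le hq1.le))
  rw [tsum_ite_eq] at hlim
  have := (tendsto_qp hq0 hq1 z).mul hlim
  simp only [← tsum_qExpBig_eq_qp_mul hq0 hq1 z, mul_one] at this
  exact tendsto_nhds_unique this tendsto_const_nhds

theorem qpInf_eq_qp_mul {q : ℝ} (hq0 : 0 < q) (hq1 : q < 1) (z : ℝ) (N : ℕ) :
    qpInf (q ^ 2) z = qp (q ^ 2) z N * qpInf (q ^ 2) ((q ^ 2) ^ N * z) := by
  rw [qpInf_eq_tsum hq0 hq1, qpInf_eq_tsum hq0 hq1, ← tsum_qExpBig_eq_qp_mul hq0 hq1]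

theorem sum_antidiagonal_qExpBig_mul_qExpSmall {q : ℝ} (hq0 : 0 < q) (hq1 : q < 1) (z : ℝ)
    (N : ℕ) : ∑ x ∈ Finset.HasAntidiagonal.antidiagonal N, qExpBig q z x.1 * qExpSmall q z x.2 =
      if N = 0 then 1 else 0 := by
  set B := PowerSeries.mk (qExpBig q z)
  set C := PowerSeries.mk (qExpSmall q z)
  set L : PowerSeries ℝ := 1 - PowerSeries.C z * PowerSeries.X
  have hB : B = L * PowerSeries.rescale (q ^ 2) B := by
    ext k
    cases k with
    | zero => simp [B, L, sub_mul, mul_assoc, -PowerSeries.coeff_zero_eq_constantCoeff,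
        PowerSeries.coeff_rescale, PowerSeries.coeff_zero_X_mul]
    | succ k =>
      have h3 := (one_sub_sq_pow_pos hq0 hq1 k).ne'
      simp only [B, L, sub_mul, mul_assoc, one_mul, map_sub, PowerSeries.coeff_C_mul,
        PowerSeries.coeff_succ_X_mul, PowerSeries.coeff_rescale, PowerSeries.coeff_mk]
      rw [qExpBig_succ hq0 hq1]
      field_simp
      ring
  have hC : PowerSeries.rescale (q ^ 2) C = L * C := by
    ext k
    cases k with
    | zero => simp [C, L, sub_mul, mul_assoc, -PowerSeries.coeff_zero_eq_constantCoeff,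
        PowerSeries.coeff_rescale, PowerSeries.coeff_zero_X_mul]
    | succ k =>
      have h3 := (one_sub_sq_pow_pos hq0 hq1 k).ne'
      simp only [C, L, sub_mul, mul_assoc, one_mul, map_sub, PowerSeries.coeff_C_mul,
        PowerSeries.coeff_succ_X_mul, PowerSeries.coeff_rescale, PowerSeries.coeff_mk]
      rw [qExpSmall_succ hq0 hq1]
      field_simp
      ring
  have hD : PowerSeries.rescale (q ^ 2) (B * C) = B * C := by
    rw [map_mul, hC]
    nth_rewrite 2 [hB]
    ring
  have hN := congrArg (PowerSeries.coeff N) hD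
  rw [PowerSeries.coeff_rescale, PowerSeries.coeff_mul] at hN
  simp only [B, C, PowerSeries.coeff_mk] at hN
  cases N with
  | zero => simp [qExpBig, qExpSmall, qp]
  | succ N =>
    have h3 := one_sub_sq_pow_pos hq0 hq1 N
    rw [if_neg (Nat.succ_ne_zero N)]
    have : (1 - (q ^ 2) ^ (N + 1)) * ∑ x ∈ Finset.HasAntidiagonal.antidiagonal (N + 1),
      qExpBig q z x.1 * qExpSmall q z x.2 = 0 := by linarith
    exact (mul_eq_zero.mp this).resolve_left h3.ne'

theorem qpInf_sq_ne_zero {q : ℝ} (hq0 : 0 < q) (hq1 : q < 1) :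
    qpInf (q ^ 2) (q ^ 2) ≠ 0 := by
  have hz : |q ^ 2| < 1 := by rw [abs_of_nonneg (sq_nonneg q)]; nlinarith
  have h := tsum_mul_tsum_eq_tsum_sum_antidiagonal_of_summable_norm
    (summable_qExpBig hq0 hq1 (q ^ 2)).norm (summable_qExpSmall hq0 hq1 hz).norm
  simp only [sum_antidiagonal_qExpBig_mul_qExpSmall hq0 hq1, tsum_ite_eq] at h
  rw [qpInf_eq_tsum hq0 hq1]
  exact left_ne_zero_of_mul_eq_one h

theorem qpInf_zpow_mul_qp {q : ℝ} (hq0 : 0 < q) (hq1 : q < 1) (j : ℕ) :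
    qpInf (q ^ 2) (q ^ (2 * (j : ℤ) + 2)) * qp (q ^ 2) (q ^ 2) j = qpInf (q ^ 2) (q ^ 2) := by
  have h : (q : ℝ) ^ (2 * (j : ℤ) + 2) = (q ^ 2) ^ j * q ^ 2 := by
    rw [← pow_mul, ← pow_add]; exact_mod_cast rfl
  rw [h, qpInf_eq_qp_mul hq0 hq1 (q ^ 2) j, mul_comm]

theorem qpInf_zpow_eq_zero {q : ℝ} (hq0 : 0 < q) {j : ℤ} (hj : j < 0) :
    qpInf (q ^ 2) (q ^ (2 * j + 2)) = 0 := by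
  refine tprod_of_exists_eq_zero ⟨(-j - 1).toNat, ?_⟩
  have h : (q ^ 2) ^ (-j - 1).toNat = q ^ (2 * (-j - 1)) := by
    rw [← pow_mul, ← zpow_natCast]
    congr 1
    push_cast
    omega
  rw [h, ← zpow_add₀ hq0.ne']
  simp [show 2 * j + 2 + 2 * (-j - 1) = 0 by ring]

theorem Jz_eq_tsum_qExpBig (q : ℝ) (n : ℤ) (x : ℝ) :
    Jz q n x = x ^ n * (∑' k : ℕ, qExpBig q (q ^ 2 * x ^ 2) k *
      qpInf (q ^ 2) (q ^ (2 * (n + k) + 2))) / qpInf (q ^ 2) (q ^ 2) := by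
  rw [Jz]
  congr 2
  refine tsum_congr fun k => ?_
  rw [qExpBig, show 2 * n + 2 + 2 * (k : ℤ) = 2 * (n + k) + 2 by ring]
  ring

/-- The symmetry of `(w;q²)_∞ ₁φ₁(0;w;q²,z)` in `z` and `w`. -/
theorem tsum_qExpBig_mul_qpInf_comm {q : ℝ} (hq0 : 0 < q) (hq1 : q < 1) (z w : ℝ) :
    ∑' k, qExpBig q z k * qpInf (q ^ 2) ((q ^ 2) ^ k * w) =
      ∑' k, qExpBig q w k * qpInf (q ^ 2) ((q ^ 2) ^ k * z) := by
  simp only [qpInf_eq_tsum hq0 hq1, ← tsum_mul_left, qExpBig_mul_pow]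
  have hs : Summable (Function.uncurry fun k j : ℕ =>
      qExpBig q z k * (((q ^ 2) ^ k) ^ j * qExpBig q w j)) := by
    refine Summable.of_norm_bounded ((summable_qExpBig hq0 hq1 z).norm.mul_norm
      (summable_qExpBig hq0 hq1 w).norm) ?_
    rintro ⟨k, j⟩
    simp only [Function.uncurry, norm_mul, norm_pow, Real.norm_of_nonneg hq0.le]
    refine mul_le_mul_of_nonneg_left (mul_le_of_le_one_left (norm_nonneg _) ?_) (norm_nonneg _)
    exact pow_le_one₀ (by positivity) (pow_le_one₀ (by positivity) (pow_le_one₀ hq0.le hq1.le))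
  rw [← hs.tsum_comm]
  refine tsum_congr fun j => tsum_congr fun k => ?_
  rw [← pow_mul, ← pow_mul, ← pow_mul, ← pow_mul]
  ring_nf

theorem Jz_zpow_comm {q : ℝ} (hq0 : 0 < q) (hq1 : q < 1) (n l : ℤ) :
    Jz q n (q ^ l) = Jz q l (q ^ n) := by
  have harg (a b : ℤ) : ∑' k : ℕ, qExpBig q (q ^ 2 * (q ^ a) ^ 2) k *
      qpInf (q ^ 2) (q ^ (2 * (b + k) + 2)) = ∑' k : ℕ, qExpBig q (q ^ 2 * (q ^ a) ^ 2) k *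
      qpInf (q ^ 2) ((q ^ 2) ^ k * (q ^ 2 * (q ^ b) ^ 2)) := by
    refine tsum_congr fun k => ?_
    congr 2
    simp only [← zpow_natCast, ← zpow_mul, ← zpow_add₀ hq0.ne']
    congr 1
    push_cast
    ring
  rw [Jz_eq_tsum_qExpBig, Jz_eq_tsum_qExpBig, harg, harg, tsum_qExpBig_mul_qpInf_comm hq0 hq1,
    ← zpow_mul, ← zpow_mul, mul_comm l n]

theorem qExpBig_add_mul_qpInf {q : ℝ} (hq0 : 0 < q) (hq1 : q < 1) (z : ℝ) (N j : ℕ) :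
    qExpBig q z (j + N) * qpInf (q ^ 2) (q ^ (2 * (j : ℤ) + 2)) =
      (-1) ^ N * q ^ (N * (N - 1)) * z ^ N * (qExpBig q ((q ^ 2) ^ N * z) j *
        qpInf (q ^ 2) (q ^ (2 * ((j + N : ℕ) : ℤ) + 2))) := by
  have h1 := (qp_sq_pos hq0 hq1 j).ne'
  have h2 := (qp_sq_pos hq0 hq1 (j + N)).ne'
  rw [eq_div_of_mul_eq h1 (qpInf_zpow_mul_qp hq0 hq1 j),
    eq_div_of_mul_eq h2 (qpInf_zpow_mul_qp hq0 hq1 (j + N)), qExpBig_mul_pow, qExpBig, qExpBig]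
  have h3 : (j + N) * (j + N - 1) = j * (j - 1) + N * (N - 1) + 2 * N * j := by
    rcases j with _ | j
    · simp
    rcases N with _ | N
    · simp
    simp only [show j + 1 + (N + 1) - 1 = j + N + 1 by omega, Nat.add_sub_cancel]
    ring
  rw [h3, pow_add q, pow_add q, ← pow_mul, ← pow_mul]
  field_simp
  ring

theorem Jz_neg {q : ℝ} (hq0 : 0 < q) (hq1 : q < 1) (N : ℕ) {x : ℝ} (hx : x ≠ 0) :
    Jz q (-N) x = (-1) ^ N * q ^ N * Jz q N (x * q ^ N) := by
  set f : ℕ → ℝ := fun k => qExpBig q (q ^ 2 * x ^ 2) k *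
    qpInf (q ^ 2) (q ^ (2 * (-(N : ℤ) + k) + 2)) with hf
  have hzero : ∀ k ∉ Set.range (· + N), f k = 0 := by
    intro k hk
    have hkN : k < N := by
      by_contra! h
      exact hk ⟨k - N, Nat.sub_add_cancel h⟩
    simp only [hf]
    rw [qpInf_zpow_eq_zero hq0 (by omega), mul_zero]
  have hshift : ∑' k, f k = ∑' j, f (j + N) :=
    ((add_left_injective N).tsum_eq fun k hk => by_contra fun h => hk (hzero k h)).symm
  rw [Jz_eq_tsum_qExpBig, Jz_eq_tsum_qExpBig, hshift]
  have hterm (j : ℕ) : f (j + N) = (-1) ^ N * q ^ (N * (N - 1)) * (q ^ 2 * x ^ 2) ^ N *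
      (qExpBig q (q ^ 2 * (x * q ^ N) ^ 2) j *
        qpInf (q ^ 2) (q ^ (2 * ((N : ℤ) + j) + 2))) := by
    have := qExpBig_add_mul_qpInf hq0 hq1 (q ^ 2 * x ^ 2) N j
    simp only [hf]
    rw [show -(N : ℤ) + ((j + N : ℕ) : ℤ) = j by push_cast; ring, this,
      show (q ^ 2) ^ N * (q ^ 2 * x ^ 2) = q ^ 2 * (x * q ^ N) ^ 2 by ring,
      show ((j + N : ℕ) : ℤ) = N + j by push_cast; ring]
  simp only [hterm]
  rw [tsum_mul_left, zpow_neg, zpow_natCast, zpow_natCast]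
  have hexp : q ^ (N * (N - 1)) * q ^ N = (q ^ N) ^ N := by
    rw [← pow_add, ← pow_mul]
    congr 1
    rcases N with _ | N
    · rfl
    simp only [Nat.add_sub_cancel]
    ring
  have hx' : (x ^ N)⁻¹ * (x ^ 2) ^ N = x ^ N := by
    rw [← pow_mul, mul_comm 2 N, pow_mul, sq]
    field_simp
  have hfactor : (x ^ N)⁻¹ * ((-1) ^ N * q ^ (N * (N - 1)) * (q ^ 2 * x ^ 2) ^ N) =
      (-1) ^ N * q ^ N * (x * q ^ N) ^ N := by
    rw [mul_pow x (q ^ N), mul_pow (q ^ 2), ← hexp]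
    linear_combination (-1) ^ N * q ^ (N * (N - 1)) * (q ^ 2) ^ N * hx'
  rw [← mul_assoc (x ^ N)⁻¹, hfactor]
  ring

/-- Convolution on `ℤ` with an absolutely summable inverse pair yields an orthogonality relation. -/
theorem tsum_correlation_eq {b c : ℤ → ℝ} (hb : Summable b) (hc : Summable c)
    (hbc : ∀ s, ∑' i, b i * c (s - i) = if s = 0 then 1 else 0) (n m : ℤ) :
    ∑' k, (∑' i, b i * c (i + (k + n))) * (∑' j, b j * c (j + (k + m))) =
      if n = m then 1 else 0 := by
  have hcn : ∀ a, ‖c a‖ ≤ ∑' a, ‖c a‖ := fun a =>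
    hc.norm.le_tsum a fun _ _ => norm_nonneg _
  have hshift (a : ℤ) : Summable fun i => b i * c (i + a) :=
    Summable.of_norm_bounded (hb.norm.mul_right (∑' a, ‖c a‖)) fun i => by
      rw [norm_mul]; exact mul_le_mul_of_nonneg_left (hcn _) (norm_nonneg _)
  have hrefl (a : ℤ) : Summable fun i => b i * c (a - i) :=
    Summable.of_norm_bounded (hb.norm.mul_right (∑' a, ‖c a‖)) fun i => by
      rw [norm_mul]; exact mul_le_mul_of_nonneg_left (hcn _) (norm_nonneg _)
  let g : ℤ × ℤ × ℤ → ℝ := fun x =>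
    (b x.2.1 * c (x.1 - x.2.1)) * (b x.2.2 * c (x.1 + (n - m) - x.2.2))
  let f : ℤ × ℤ × ℤ → ℝ := fun x =>
    (b x.2.1 * c (x.2.1 + (x.1 + n))) * (b x.2.2 * c (x.2.2 + (x.1 + m)))
  let e : ℤ × ℤ × ℤ ≃ ℤ × ℤ × ℤ :=
    { toFun := fun x => (x.2.1 + x.2.2 + x.1 + m, x.2.1, x.2.2)
      invFun := fun x => (x.1 - x.2.1 - x.2.2 - m, x.2.1, x.2.2)
      left_inv := fun x => by ext <;> simp; ring
      right_inv := fun x => by ext <;> simp; ring }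
  let e' : ℤ × ℤ × ℤ ≃ (ℤ × ℤ) × ℤ :=
    { toFun := fun x => ((x.2.1, x.1 - x.2.1), x.2.2)
      invFun := fun x => (x.1.1 + x.1.2, x.1.1, x.2)
      left_inv := fun x => by ext <;> simp
      right_inv := fun x => by ext <;> simp }
  have hfg : f = g ∘ e := by
    ext ⟨k, i, j⟩
    simp only [f, g, e, Function.comp_apply, Equiv.coe_fn_mk]
    rw [show i + j + k + m - i = j + (k + m) by ring,
      show i + j + k + m + (n - m) - j = i + (k + n) by ring]
    ring
  have hg : Summable g := by
    have h := (((hb.norm.mul_norm hc.norm).mul_norm hb.norm).mul_right (∑' a, ‖c a‖))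
    refine Summable.of_norm_bounded (e'.summable_iff.mpr h) ?_
    rintro ⟨s, i, j⟩
    simp only [g, e', Function.comp_apply, Equiv.coe_fn_mk, norm_mul]
    rw [← mul_assoc]
    exact mul_le_mul_of_nonneg_left (hcn _) (by positivity)
  have hf : Summable f := hfg ▸ e.summable_iff.mpr hg
  have hsplit {u v : ℤ → ℝ} (hu : Summable u) (hv : Summable v) :
      (∑' i, u i) * (∑' j, v j) = ∑' x : ℤ × ℤ, u x.1 * v x.2 :=
    tsum_mul_tsum_of_summable_norm hu.norm hv.norm
  calc _ = ∑' k, ∑' x : ℤ × ℤ, f (k, x) :=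
        tsum_congr fun k => hsplit (hshift (k + n)) (hshift (k + m))
    _ = ∑' x, f x := hf.tsum_prod.symm
    _ = ∑' x, g x := by rw [hfg]; exact e.tsum_eq g
    _ = ∑' s, ∑' x : ℤ × ℤ, g (s, x) := hg.tsum_prod
    _ = ∑' s, (∑' i, b i * c (s - i)) * (∑' j, b j * c (s + (n - m) - j)) :=
        tsum_congr fun s => (hsplit (hrefl s) (hrefl (s + (n - m)))).symm
    _ = ∑' s : ℤ, if s = 0 then (if n = m then (1 : ℝ) else 0) else 0 := by
        refine tsum_congr fun s => ?_
        rw [hbc, hbc]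
        split_ifs <;> first | omega | simp
    _ = _ := tsum_ite_eq 0 _

/-- Extension by zero of a sequence from `ℕ` to `ℤ`. -/
noncomputable def zeroExtend (u : ℕ → ℝ) : ℤ → ℝ := Function.extend (Nat.cast : ℕ → ℤ) u 0

theorem zeroExtend_natCast (u : ℕ → ℝ) (k : ℕ) : zeroExtend u k = u k :=
  Nat.cast_injective.extend_apply u 0 k

theorem zeroExtend_of_neg (u : ℕ → ℝ) {k : ℤ} (hk : k < 0) : zeroExtend u k = 0 :=
  Function.extend_apply' _ _ _ (by rintro ⟨a, rfl⟩; omega)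

theorem summable_zeroExtend {u : ℕ → ℝ} (hu : Summable u) : Summable (zeroExtend u) :=
  (summable_extend_zero Nat.cast_injective).mpr hu

theorem tsum_zeroExtend_mul (u : ℕ → ℝ) (v : ℤ → ℝ) :
    ∑' i, zeroExtend u i * v i = ∑' k : ℕ, u k * v k := by
  rw [← Nat.cast_injective.tsum_eq (f := fun i : ℤ => zeroExtend u i * v i)]
  · simp only [zeroExtend_natCast]
  · intro i hi
    by_contra h
    refine hi ?_
    have : i < 0 := by
      by_contra! h0
      exact h ⟨i.toNat, Int.toNat_of_nonneg h0⟩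
    simp [zeroExtend_of_neg u this]

theorem tsum_zeroExtend_convolution (u v : ℕ → ℝ) (s : ℤ) :
    ∑' i, zeroExtend u i * zeroExtend v (s - i) =
      zeroExtend (fun N => ∑ x ∈ Finset.HasAntidiagonal.antidiagonal N, u x.1 * v x.2) s := by
  rw [tsum_zeroExtend_mul u fun i => zeroExtend v (s - i)]
  rcases lt_or_ge s 0 with hs | hs
  · rw [zeroExtend_of_neg _ hs]
    refine (tsum_congr fun k => ?_).trans tsum_zero
    rw [zeroExtend_of_neg v (by omega), mul_zero]
  · lift s to ℕ using hs
    rw [zeroExtend_natCast, Finset.Nat.sum_antidiagonal_eq_sum_range_succ (fun i j => u i * v j),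
      tsum_eq_sum (s := Finset.range s.succ)]
    · refine Finset.sum_congr rfl fun k hk => ?_
      have hk : k ≤ s := Nat.lt_succ_iff.mp (Finset.mem_range.mp hk)
      rw [← Nat.cast_sub hk, zeroExtend_natCast]
    · intro k hk
      have hk : s < k := by simpa using hk
      rw [zeroExtend_of_neg v (by omega), mul_zero]

theorem zpow_mul_Jz_eq_tsum {q : ℝ} (hq0 : 0 < q) (hq1 : q < 1) (n : ℤ) {x : ℝ} (hx : x ≠ 0) :
    q ^ n * Jz q n x = ∑' i, zeroExtend (qExpBig q (q * x)) i *
      zeroExtend (qExpSmall q (q * x)) (i + n) := by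
  rw [tsum_zeroExtend_mul _ fun i => zeroExtend (qExpSmall q (q * x)) (i + n),
    Jz_eq_tsum_qExpBig, mul_div_assoc, ← tsum_div_const, ← tsum_mul_left, ← tsum_mul_left]
  refine tsum_congr fun k => ?_
  have hinf := qpInf_sq_ne_zero hq0 hq1
  rcases lt_or_ge ((k : ℤ) + n) 0 with hk | hk
  · rw [zeroExtend_of_neg _ hk, qpInf_zpow_eq_zero hq0 (by omega)]
    simp
  · obtain ⟨j, hj⟩ := Int.eq_ofNat_of_zero_le hk
    have hpow : (q * x) ^ j = q ^ n * x ^ n * (q * x) ^ k := by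
      rw [← mul_zpow, ← zpow_natCast, ← zpow_natCast, ← zpow_add₀ (mul_ne_zero hq0.ne' hx),
        ← hj, add_comm]
    have h1 := (qp_sq_pos hq0 hq1 j).ne'
    rw [hj, zeroExtend_natCast, show n + (k : ℤ) = j by omega,
      eq_div_of_mul_eq h1 (qpInf_zpow_mul_qp hq0 hq1 j), qExpSmall, hpow,
      show q ^ 2 * x ^ 2 = (q * x) * (q * x) by ring, qExpBig_mul_pow]
    field_simp

theorem zpow_mul_Jz_zpow_neg {q : ℝ} (hq0 : 0 < q) (hq1 : q < 1) (n : ℤ) (N : ℕ) :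
    q ^ n * Jz q n (q ^ (-(N : ℤ))) = (-1) ^ N * (q ^ (n + N) * Jz q (n + N) (q ^ (N : ℤ))) := by
  have hmul : q ^ n * q ^ N = q ^ (n + N) := by rw [zpow_add₀ hq0.ne', zpow_natCast]
  rw [Jz_zpow_comm hq0 hq1, Jz_neg hq0 hq1 N (zpow_ne_zero n hq0.ne'), hmul,
    Jz_zpow_comm hq0 hq1 (n + N), ← hmul]
  ring

theorem tsum_Jz_mul_Jz_of_nonneg {q : ℝ} (hq0 : 0 < q) (hq1 : q < 1) (n m : ℤ) (N : ℕ) :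
    ∑' k : ℤ, (q ^ (k + n) * Jz q (k + n) (q ^ (N : ℤ))) *
      (q ^ (k + m) * Jz q (k + m) (q ^ (N : ℤ))) = if n = m then (1 : ℝ) else 0 := by
  have hx : q ^ (N : ℤ) ≠ 0 := zpow_ne_zero _ hq0.ne'
  have hy : |q * q ^ (N : ℤ)| < 1 := by
    rw [zpow_natCast, ← pow_succ', abs_of_pos (by positivity)]
    exact pow_lt_one₀ hq0.le hq1 (Nat.succ_ne_zero N)
  simp only [zpow_mul_Jz_eq_tsum hq0 hq1 _ hx]
  refine tsum_correlation_eq (summable_zeroExtend (summable_qExpBig hq0 hq1 _))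
    (summable_zeroExtend (summable_qExpSmall hq0 hq1 hy)) (fun s => ?_) n m
  rw [tsum_zeroExtend_convolution]
  simp only [sum_antidiagonal_qExpBig_mul_qExpSmall hq0 hq1]
  rcases lt_or_ge s 0 with hs | hs
  · rw [zeroExtend_of_neg _ hs, if_neg hs.ne]
  · lift s to ℕ using hs
    simp [zeroExtend_natCast]

/-- Hansen–Lommel type orthogonality for the `₁φ₁` q-Bessel functions. -/
theorem qBessel_hansen_lommel (q : ℝ) (hq0 : 0 < q) (hq1 : q < 1) (n m l : ℤ) :
    ∑' k : ℤ, (q ^ (k + n) * Jz q (k + n) (q ^ l)) * (q ^ (k + m) * Jz q (k + m) (q ^ l)) =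
      if n = m then (1 : ℝ) else 0 := by
  obtain ⟨N, rfl | rfl⟩ := l.eq_nat_or_neg
  · exact tsum_Jz_mul_Jz_of_nonneg hq0 hq1 n m N
  · have hsign : ((-1 : ℝ) ^ N) * (-1) ^ N = 1 := by rw [← mul_pow]; simp
    have h := tsum_Jz_mul_Jz_of_nonneg hq0 hq1 (n + N) (m + N) N
    simp only [add_left_inj, ← add_assoc] at h
    rw [← h]
    refine tsum_congr fun k => ?_
    rw [zpow_mul_Jz_zpow_neg hq0 hq1, zpow_mul_Jz_zpow_neg hq0 hq1, mul_mul_mul_comm, hsign,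
      one_mul]
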